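/- arXiv:2305.02434 — 4 statements merged into one kernel-verified Lean document; each statement's English description precedes it below -/
import Mathlib

section
/- Define p̂_u^{Chernoff} = p̂ + log(2/α)/n + √((log(2/α))²/n² + 2 p̂ log(2/α)/n) and p̂_l^{Chernoff} = p̂ + log(2/α)/(2n) − √((log(2/α))²/(4n²) + 2 p̂ log(2/α)/n). Then P(p̂_l^{Chernoff} ≤ p ≤ p̂_u^{Chernoff}) ≥ 1 − α, for every n ≥ 1 and every p ∈ (0,1). -/
open scoped Classical in
/-- Probability that a Binomial(n,p) variable `X` satisfies predicate `Q`. -/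
noncomputable def binProb (n : ℕ) (p : ℝ) (Q : ℕ → Prop) : ℝ :=
  ∑ k ∈ Finset.range (n + 1),
    if Q k then (n.choose k : ℝ) * p ^ k * (1 - p) ^ (n - k) else 0

lemma binProb_true (n : ℕ) (p : ℝ) : binProb n p (fun _ => True) = 1 := by
  have h := add_pow p (1 - p) n
  rw [add_sub_cancel, one_pow] at h
  rw [h, binProb]
  refine Finset.sum_congr rfl fun k _ => ?_
  rw [if_pos trivial]
  ring

lemma binomial_weight_nonneg {p : ℝ} (hp : 0 ≤ p) (hp1 : p ≤ 1) (n k : ℕ) :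
    0 ≤ (n.choose k : ℝ) * p ^ k * (1 - p) ^ (n - k) := by
  have : 0 ≤ 1 - p := sub_nonneg.mpr hp1
  positivity

/-- Union bound for the binomial law. -/
lemma one_le_binProb_add_add {p : ℝ} (hp : 0 ≤ p) (hp1 : p ≤ 1) (n : ℕ) {P Q R : ℕ → Prop}
    (h : ∀ k, P k ∨ Q k ∨ R k) : 1 ≤ binProb n p P + binProb n p Q + binProb n p R := by
  rw [← binProb_true n p]
  simp only [binProb, ← Finset.sum_add_distrib]
  refine Finset.sum_le_sum fun k _ => ?_
  have hw := binomial_weight_nonneg hp hp1 n k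
  have := h k
  split_ifs <;> first | linarith | tauto

/-- Exponential Markov inequality for the binomial law, with the moment generating function
bounded by that of the Poisson law with the same mean. -/
lemma binProb_le_exp {p : ℝ} (hp : 0 ≤ p) (hp1 : p ≤ 1) (n : ℕ) (t c : ℝ) {Q : ℕ → Prop}
    (h : ∀ k, Q k → c ≤ t * k) :
    binProb n p Q ≤ Real.exp (n * (p * (Real.exp t - 1)) - c) := by
  have hmgf : binProb n p Q ≤ (p * Real.exp t + (1 - p)) ^ n * Real.exp (-c) := by
    rw [add_pow, Finset.sum_mul, binProb]
    refine Finset.sum_le_sum fun k _ => ?_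
    have hw := binomial_weight_nonneg hp hp1 n k
    have he : (p * Real.exp t) ^ k * (1 - p) ^ (n - k) * (n.choose k : ℝ) * Real.exp (-c)
        = (n.choose k : ℝ) * p ^ k * (1 - p) ^ (n - k) * Real.exp (t * k - c) := by
      rw [sub_eq_add_neg (t * k), Real.exp_add, mul_comm t, Real.exp_nat_mul]
      ring
    rw [he]
    split_ifs with hQ
    · exact le_mul_of_one_le_right hw (Real.one_le_exp (sub_nonneg.mpr (h k hQ)))
    · positivity
  refine hmgf.trans ?_
  rw [sub_eq_add_neg _ c, Real.exp_add, Real.exp_nat_mul]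
  have h0 : 0 ≤ p * Real.exp t + (1 - p) :=
    add_nonneg (by positivity) (sub_nonneg.mpr hp1)
  gcongr
  linarith [Real.add_one_le_exp (p * (Real.exp t - 1))]

lemma exp_neg_le_quadratic {x : ℝ} (hx : 0 ≤ x) : Real.exp (-x) ≤ 1 - x + x ^ 2 / 2 := by
  rw [Real.exp_neg, inv_le_iff_one_le_mul₀ (Real.exp_pos x)]
  have h := Real.quadratic_le_exp_of_nonneg hx
  have h' : 0 ≤ 1 - x + x ^ 2 / 2 := by nlinarith [sq_nonneg (x - 1)]
  nlinarith [mul_le_mul_of_nonneg_left h h', sq_nonneg (x ^ 2)]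

/-- Multiplicative Chernoff bound for the lower tail. -/
lemma binProb_lower_tail {p : ℝ} (hp : 0 < p) (hp1 : p ≤ 1) (n : ℕ) {δ : ℝ} (hδ : 0 ≤ δ) :
    binProb n p (fun k => (k : ℝ) ≤ n * (p * (1 - δ))) ≤ Real.exp (-(n * (p * δ ^ 2 / 2))) := by
  refine (binProb_le_exp hp.le hp1 n (-δ) (-δ * (n * (p * (1 - δ)))) fun k hk =>
    mul_le_mul_of_nonpos_left hk (neg_nonpos.mpr hδ)).trans (Real.exp_le_exp.mpr ?_)
  have h : (n : ℝ) * (p * (Real.exp (-δ) - 1)) ≤ n * (p * (1 - δ + δ ^ 2 / 2 - 1)) := by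
    gcongr
    exact exp_neg_le_quadratic hδ
  linarith

/-- Multiplicative Chernoff bound for the upper tail. -/
lemma binProb_upper_tail {p : ℝ} (hp : 0 < p) (hp1 : p ≤ 1) (n : ℕ) {δ : ℝ} (hδ : 0 ≤ δ) :
    binProb n p (fun k => n * (p * (1 + δ)) ≤ (k : ℝ)) ≤
      Real.exp (-(n * (p * (δ ^ 2 / (2 + δ))))) := by
  have hlog := Real.le_log_one_add_of_nonneg hδ
  have hlog0 : 0 ≤ Real.log (1 + δ) := Real.log_nonneg (by linarith)
  refine (binProb_le_exp hp.le hp1 n (Real.log (1 + δ)) (Real.log (1 + δ) * (n * (p * (1 + δ))))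
    fun k hk => mul_le_mul_of_nonneg_left hk hlog0).trans (Real.exp_le_exp.mpr ?_)
  rw [Real.exp_log (by linarith)]
  have h : (n : ℝ) * (p * ((1 + δ) * (2 * δ / (δ + 2)))) ≤
      n * (p * ((1 + δ) * Real.log (1 + δ))) := by gcongr
  have h' : (1 + δ) * (2 * δ / (δ + 2)) = δ + δ ^ 2 / (2 + δ) := by
    field_simp
    ring
  rw [h'] at h
  linarith

/-- Failure of the upper confidence limit `q + L + √(L² + 2qL)` forces a small `q`. -/
lemma le_sub_sqrt_of_upper_limit_lt {p q L : ℝ} (hL : 0 ≤ L)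
    (h : q + L + √(L ^ 2 + 2 * q * L) < p) : q ≤ p - √(2 * p * L) := by
  have hs := Real.sqrt_nonneg (L ^ 2 + 2 * q * L)
  have h2 : √(L ^ 2 + 2 * q * L) < p - q - L := by linarith
  rw [Real.sqrt_lt' (by linarith)] at h2
  have : √(2 * p * L) ≤ p - q := Real.sqrt_le_iff.mpr ⟨by linarith, by nlinarith⟩
  linarith

/-- Failure of the lower confidence limit `q + L/2 - √(L²/4 + 2qL)` forces a large `q`. -/
lemma add_sqrt_le_of_lt_lower_limit {p q L : ℝ} (hp : 0 < p) (hq : 0 ≤ q) (hL : 0 < L)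
    (h : p < q + L / 2 - √(L ^ 2 / 4 + 2 * q * L)) :
    p + L / 2 + √(L ^ 2 / 4 + 2 * p * L) ≤ q := by
  have hs : L / 2 ≤ √(L ^ 2 / 4 + 2 * q * L) := Real.le_sqrt_of_sq_le (by nlinarith)
  have h2 : √(L ^ 2 / 4 + 2 * q * L) < q + L / 2 - p := by linarith
  rw [Real.sqrt_lt' (by linarith)] at h2
  have hpq : p < q := by linarith
  have hLq : L < q - p := by
    by_contra! hc
    nlinarith
  have : √(L ^ 2 / 4 + 2 * p * L) ≤ q - p - L / 2 :=
    Real.sqrt_le_iff.mpr ⟨by linarith, by nlinarith⟩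
  linarith

/-- Chernoff's CI `[p̂_l^{Chernoff}, p̂_u^{Chernoff}]` (with `p̂ = X/n`)
covers the true `p` with probability at least `1 − α`, for every `n ≥ 1` and `p ∈ (0,1)`. -/
theorem stmt2 (n : ℕ) (hn : 1 ≤ n) (p α : ℝ) (hp : 0 < p) (hp1 : p < 1)
    (hα : 0 < α) (hα1 : α < 1) :
    binProb n p (fun k =>
      (k : ℝ) / n + Real.log (2 / α) / (2 * n)
          - Real.sqrt ((Real.log (2 / α)) ^ 2 / (4 * (n : ℝ) ^ 2)
              + 2 * ((k : ℝ) / n) * Real.log (2 / α) / n) ≤ p ∧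
      p ≤ (k : ℝ) / n + Real.log (2 / α) / n
          + Real.sqrt ((Real.log (2 / α)) ^ 2 / (n : ℝ) ^ 2
              + 2 * ((k : ℝ) / n) * Real.log (2 / α) / n)) ≥ 1 - α := by
  have hn0 : (0 : ℝ) < n := by exact_mod_cast hn
  have hlog : 0 < Real.log (2 / α) := Real.log_pos (by rw [lt_div_iff₀ hα]; linarith)
  obtain ⟨L, hLdef⟩ : ∃ L, L = Real.log (2 / α) / n := ⟨_, rfl⟩
  have hL : 0 < L := hLdef ▸ div_pos hlog hn0
  have hlogL : Real.log (2 / α) = n * L := by rw [hLdef]; field_simp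
  have hexp : Real.exp (-(n * L)) = α / 2 := by
    rw [← hlogL, Real.exp_neg, Real.exp_log (by positivity), inv_div]
  -- The deviations from `p` at which the two tail bounds equal `α / 2`.
  obtain ⟨a, ha⟩ : ∃ a, a = √(2 * p * L) := ⟨_, rfl⟩
  obtain ⟨b, hb⟩ : ∃ b, b = L / 2 + √(L ^ 2 / 4 + 2 * p * L) := ⟨_, rfl⟩
  have ha0 : 0 ≤ a := ha ▸ Real.sqrt_nonneg _
  have hb0 : 0 ≤ b := hb ▸ by positivity
  have ha2 : a ^ 2 = 2 * p * L := ha ▸ Real.sq_sqrt (by positivity)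
  have hb2 : b ^ 2 = L * (2 * p + b) := by
    have := Real.sq_sqrt (show 0 ≤ L ^ 2 / 4 + 2 * p * L by positivity)
    rw [show √(L ^ 2 / 4 + 2 * p * L) = b - L / 2 by linarith] at this
    linarith
  have hlow := binProb_lower_tail hp hp1.le n (div_nonneg ha0 hp.le)
  have hupp := binProb_upper_tail hp hp1.le n (div_nonneg hb0 hp.le)
  have ea : p * (a / p) ^ 2 / 2 = L := by
    rw [div_pow, ha2]; field_simp
  have eb : p * ((b / p) ^ 2 / (2 + b / p)) = L := by
    rw [div_pow, hb2]; field_simp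
  rw [ea, hexp, show p * (1 - a / p) = p - a by field_simp] at hlow
  rw [eb, hexp, show p * (1 + b / p) = p + b by field_simp] at hupp
  suffices hunion : ∀ k : ℕ, _ ∨ (k : ℝ) ≤ n * (p - a) ∨ n * (p + b) ≤ (k : ℝ) by
    linarith [one_le_binProb_add_add hp.le hp1.le n hunion]
  intro k
  obtain ⟨q, hq⟩ : ∃ q : ℝ, q = k / n := ⟨_, rfl⟩
  have hq0 : 0 ≤ q := hq ▸ by positivity
  have hk : (k : ℝ) = n * q := by rw [hq]; field_simp
  rw [← hq, hlogL, hk, mul_le_mul_iff_right₀ hn0, mul_le_mul_iff_right₀ hn0,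
    show (n : ℝ) * L / (2 * n) = L / 2 by field_simp,
    show ((n : ℝ) * L) ^ 2 / (4 * (n : ℝ) ^ 2) = L ^ 2 / 4 by field_simp,
    show 2 * q * (n * L) / n = 2 * q * L by field_simp,
    show (n : ℝ) * L / n = L by field_simp,
    show ((n : ℝ) * L) ^ 2 / (n : ℝ) ^ 2 = L ^ 2 by field_simp]
  by_contra! hc
  obtain ⟨hcover, hlo, hup⟩ := hc
  rcases le_or_gt (q + L / 2 - √(L ^ 2 / 4 + 2 * q * L)) p with h | h
  · have := le_sub_sqrt_of_upper_limit_lt hL.le (hcover h)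
    linarith
  · have := add_sqrt_le_of_lt_lower_limit hp hq0 hL h
    linarith
end

section
/- Assume p < 1/2. Then the probability of the event that either (p ≤ p̂ and Φ((p−p̂)·√(n/(p(1−p)))) + C/√(np(1−p)) ≥ α/2) or (p̂ ≤ p and Φ((p̂−p)·√(n/(p(1−p)))) + C/√(np(1−p)) ≥ α/2) is at least 1 − α; that is, the Berry–Esseen confidence region {q ∈ (0, min(p̂,1/2)] : Φ((q−p̂)√(n/(q(1−q)))) + C/√(nq(1−q)) ≥ α/2} ∪ {q ∈ [p̂, 1/2) : Φ((p̂−q)√(n/(q(1−q)))) + C/√(nq(1−q)) ≥ α/2} covers the true p with probability at least 1 − α. -/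
open MeasureTheory

/-- The standard normal CDF. -/
noncomputable def Phi (x : ℝ) : ℝ :=
  ∫ t in Set.Iic x, Real.exp (-(t ^ 2) / 2) / Real.sqrt (2 * Real.pi)

lemma binProb_mono {n : ℕ} {p : ℝ} (hp0 : 0 ≤ p) (hp1 : p ≤ 1) {Q R : ℕ → Prop}
    (h : ∀ k ≤ n, Q k → R k) : binProb n p Q ≤ binProb n p R := by
  refine Finset.sum_le_sum fun k hk => ?_
  have hk' : k ≤ n := Nat.lt_succ_iff.mp (Finset.mem_range.mp hk)
  have h1p : 0 ≤ 1 - p := sub_nonneg.mpr hp1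
  have hw : 0 ≤ (n.choose k : ℝ) * p ^ k * (1 - p) ^ (n - k) := by positivity
  by_cases hQ : Q k
  · simp [hQ, h k hk' hQ]
  · rw [if_neg hQ]
    split_ifs <;> simp [hw]

lemma binProb_or_le {n : ℕ} {p : ℝ} (hp0 : 0 ≤ p) (hp1 : p ≤ 1) (Q R : ℕ → Prop) :
    binProb n p (fun k => Q k ∨ R k) ≤ binProb n p Q + binProb n p R := by
  unfold binProb
  rw [← Finset.sum_add_distrib]
  refine Finset.sum_le_sum fun k _ => ?_
  have h1p : 0 ≤ 1 - p := sub_nonneg.mpr hp1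
  have hw : 0 ≤ (n.choose k : ℝ) * p ^ k * (1 - p) ^ (n - k) := by positivity
  by_cases hQ : Q k <;> by_cases hR : R k <;> simp [hQ, hR, hw]

lemma binProb_add_binProb_not (n : ℕ) (p : ℝ) (Q : ℕ → Prop) :
    binProb n p Q + binProb n p (fun k => ¬ Q k) = 1 := by
  have hsum := add_pow p (1 - p) n
  rw [add_sub_cancel, one_pow] at hsum
  unfold binProb
  rw [← Finset.sum_add_distrib]
  refine Eq.trans (Finset.sum_congr rfl fun k _ => ?_) hsum.symm
  by_cases hQ : Q k
  · simp [hQ]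
    ring
  · simp [hQ]
    ring

/-- The p-value of the statistic `f` is stochastically larger than a uniform variable. -/
lemma binProb_pvalue_lt_le {n : ℕ} {p : ℝ} (hp0 : 0 ≤ p) (hp1 : p ≤ 1) (f : ℕ → ℝ) {a : ℝ}
    (ha : 0 ≤ a) : binProb n p (fun k => binProb n p (fun j => f k ≤ f j) < a) ≤ a := by
  classical
  set S := (Finset.range (n + 1)).filter fun k => binProb n p (fun j => f k ≤ f j) < a
  rcases S.eq_empty_or_nonempty with hemp | hne
  · refine le_of_eq_of_le (Finset.sum_eq_zero fun k hk => if_neg fun hlt => ?_) ha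
    exact Finset.notMem_empty k (hemp ▸ Finset.mem_filter.mpr ⟨hk, hlt⟩)
  · obtain ⟨m, hm, hmin⟩ := S.exists_min_image f hne
    refine le_trans (binProb_mono hp0 hp1 fun k hk hlt => ?_) (Finset.mem_filter.mp hm).2.le
    exact hmin k (Finset.mem_filter.mpr ⟨Finset.mem_range.mpr (Nat.lt_succ_of_le hk), hlt⟩)

/-- assuming `p < 1/2` and that `C` satisfies the Berry–Esseen bound for the
binomial sum, the Berry–Esseen confidence region covers the true `p`
with probability at least `1 − α`. -/
theorem stmt3 (n : ℕ) (hn : 1 ≤ n) (p α C : ℝ) (hp : 0 < p) (hp2 : p < 1 / 2)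
    (hα : 0 < α) (hα1 : α < 1) (hC : 0 < C)
    (hBE1 : ∀ x : ℝ,
      |binProb n p (fun k => (k : ℝ) ≤ n * x)
          - Phi ((x - p) * Real.sqrt (n / (p * (1 - p))))|
        ≤ C / Real.sqrt (n * p * (1 - p)))
    (hBE2 : ∀ x : ℝ,
      |binProb n p (fun k => (k : ℝ) ≥ n * x)
          - Phi ((p - x) * Real.sqrt (n / (p * (1 - p))))|
        ≤ C / Real.sqrt (n * p * (1 - p))) :
    binProb n p (fun k =>
      (p ≤ (k : ℝ) / n ∧
        Phi ((p - (k : ℝ) / n) * Real.sqrt (n / (p * (1 - p))))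
          + C / Real.sqrt (n * p * (1 - p)) ≥ α / 2) ∨
      ((k : ℝ) / n ≤ p ∧
        Phi (((k : ℝ) / n - p) * Real.sqrt (n / (p * (1 - p))))
          + C / Real.sqrt (n * p * (1 - p)) ≥ α / 2)) ≥ 1 - α := by
  have hp1 : p ≤ 1 := by linarith
  have hn0 : (n : ℝ) ≠ 0 := by positivity
  have hcancel : ∀ k : ℕ, (n : ℝ) * ((k : ℝ) / n) = k := fun k => mul_div_cancel₀ _ hn0
  have hupper := binProb_pvalue_lt_le (n := n) hp.le hp1 (fun k => (k : ℝ)) (half_pos hα).le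
  have hlower := binProb_pvalue_lt_le (n := n) hp.le hp1 (fun k => -(k : ℝ)) (half_pos hα).le
  simp only [neg_le_neg_iff] at hlower
  rw [ge_iff_le, sub_le_iff_le_add]
  refine le_of_eq_of_le (binProb_add_binProb_not n p _).symm (add_le_add le_rfl ?_)
  refine le_trans (le_trans (binProb_mono hp.le hp1 fun k _ hk => ?_)
    (binProb_or_le hp.le hp1 _ _)) (le_of_le_of_eq (add_le_add hupper hlower) (add_halves α))
  rw [not_or, not_and, not_and, not_le, not_le] at hk
  rcases le_total p ((k : ℝ) / n) with hle | hle
  · have hbound := (abs_le.mp (hBE2 ((k : ℝ) / n))).2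
    simp only [hcancel, ge_iff_le] at hbound
    left
    linarith [hk.1 hle]
  · have hbound := (abs_le.mp (hBE1 ((k : ℝ) / n))).2
    simp only [hcancel] at hbound
    right
    linarith [hk.2 hle]
end

section
/- Let z = z_{1−α/2}. Define p̂_u^{CLT} = p̂ + z√(p̂(1−p̂)/n), p̂_l^{CLT} = p̂ − z√(p̂(1−p̂)/n), p̂_u^{Chernoff} = p̂ + log(2/α)/n + √((log(2/α))²/n² + 2p̂ log(2/α)/n), and p̂_l^{Chernoff} = p̂ + log(2/α)/(2n) − √((log(2/α))²/(4n²) + 2p̂ log(2/α)/n). Then for every integer n ≥ 1 and every p̂ ∈ [0,1]: p̂_u^{Chernoff} − p̂_u^{CLT} ≥ (√(2 log(2/α)) − z)·√(p̂/n) + log(2/α)/n, and p̂_l^{CLT} − p̂_l^{Chernoff} ≥ (√(2 log(2/α)) − z)·√(p̂/n) − log(2/α)/(2n). -/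
open MeasureTheory

/-- The standard normal CDF takes the value `1 / 2` at the origin. -/
theorem Phi_zero : Phi 0 = 1 / 2 := by
  have hIoi := integral_gaussian_Ioi (1 / 2)
  have hIic := integral_comp_neg_Iic (0 : ℝ) (fun t : ℝ => Real.exp (-(1 / 2) * t ^ 2))
  simp only [neg_sq, neg_zero, hIoi] at hIic
  have hexp : ∀ t : ℝ, -(t ^ 2) / 2 = -(1 / 2) * t ^ 2 := fun t => by ring
  have hpi : Real.sqrt (2 * Real.pi) ≠ 0 := by positivity
  simp only [Phi, hexp]
  rw [integral_div, hIic, show Real.pi / (1 / 2) = 2 * Real.pi by ring]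
  field_simp

theorem integrable_standard_gaussian_density :
    Integrable (fun t : ℝ => Real.exp (-(t ^ 2) / 2) / Real.sqrt (2 * Real.pi)) := by
  have h := (integrable_exp_neg_mul_sq (b := 1 / 2) (by norm_num)).div_const
    (Real.sqrt (2 * Real.pi))
  refine h.congr (Filter.Eventually.of_forall fun t => ?_)
  simp only
  congr 2
  ring

theorem Phi_monotone : Monotone Phi := fun _ _ hxy =>
  setIntegral_mono_set integrable_standard_gaussian_density.integrableOn
    (Filter.Eventually.of_forall fun _ => by positivity)
    (Set.Iic_subset_Iic.2 hxy).eventuallyLE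

theorem nonneg_of_half_lt_Phi {z : ℝ} (hz : 1 / 2 < Phi z) : 0 ≤ z :=
  (Phi_monotone.reflect_lt (Phi_zero.trans_lt hz)).le

/-- `√(2L)·√(p/n)` is bounded by the square root appearing in the Chernoff bounds. -/
theorem sqrt_mul_sqrt_div_le_sqrt_add {L p n c : ℝ} (hL : 0 ≤ L) (hc : 0 ≤ c) :
    Real.sqrt (2 * L) * Real.sqrt (p / n) ≤ Real.sqrt (c + 2 * p * L / n) := by
  rw [← Real.sqrt_mul (by positivity)]
  apply Real.sqrt_le_sqrt
  have : 2 * L * (p / n) = 2 * p * L / n := by ring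
  linarith

/-- with `z = z_{1−α/2}`, for every `n ≥ 1` and `p̂ ∈ [0,1]`:
`p̂_u^{Chernoff} − p̂_u^{CLT} ≥ (√(2 log(2/α)) − z)·√(p̂/n) + log(2/α)/n` and
`p̂_l^{CLT} − p̂_l^{Chernoff} ≥ (√(2 log(2/α)) − z)·√(p̂/n) − log(2/α)/(2n)`. -/
theorem stmt5 (α z : ℝ) (hα : 0 < α) (hα1 : α < 1) (hz : Phi z = 1 - α / 2) :
    ∀ n : ℕ, 1 ≤ n → ∀ phat : ℝ, 0 ≤ phat → phat ≤ 1 →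
    ((phat + Real.log (2 / α) / n +
        Real.sqrt ((Real.log (2 / α)) ^ 2 / (n : ℝ) ^ 2 + 2 * phat * Real.log (2 / α) / n))
      - (phat + z * Real.sqrt (phat * (1 - phat) / n))
      ≥ (Real.sqrt (2 * Real.log (2 / α)) - z) * Real.sqrt (phat / n)
          + Real.log (2 / α) / n) ∧
    ((phat - z * Real.sqrt (phat * (1 - phat) / n))
      - (phat + Real.log (2 / α) / (2 * n) -
          Real.sqrt ((Real.log (2 / α)) ^ 2 / (4 * (n : ℝ) ^ 2)
            + 2 * phat * Real.log (2 / α) / n))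
      ≥ (Real.sqrt (2 * Real.log (2 / α)) - z) * Real.sqrt (phat / n)
          - Real.log (2 / α) / (2 * n)) := by
  intro n _ p hp _
  have hz0 : 0 ≤ z := nonneg_of_half_lt_Phi (by linarith)
  have hL : 0 ≤ Real.log (2 / α) :=
    Real.log_nonneg ((one_le_div hα).2 (by linarith))
  have hvar : z * Real.sqrt (p * (1 - p) / n) ≤ z * Real.sqrt (p / n) := by
    gcongr
    nlinarith
  have hu := sqrt_mul_sqrt_div_le_sqrt_add (p := p) (n := n) hL
    (show 0 ≤ Real.log (2 / α) ^ 2 / (n : ℝ) ^ 2 by positivity)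
  have hl := sqrt_mul_sqrt_div_le_sqrt_add (p := p) (n := n) hL
    (show 0 ≤ Real.log (2 / α) ^ 2 / (4 * (n : ℝ) ^ 2) by positivity)
  constructor <;> linarith
end

section
/- For every real x with x > n0/p, the upper tail satisfies P(N ≥ x) ≤ (1−p)^{x−n0} · x^x · p^{n0} / ((x−n0)^{x−n0} · n0^{n0}), where the powers with real exponents are real powers of positive bases. -/
open scoped Classical in
/-- Probability that the negative-binomial sample size `N` (number of Bernoulli(p) trials
until `n0` successes) satisfies predicate `Q`. -/
noncomputable def nbProb (n0 : ℕ) (p : ℝ) (Q : ℕ → Prop) : ℝ :=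
  ∑' k : ℕ,
    if Q (n0 + k) then ((n0 + k - 1).choose (n0 - 1) : ℝ) * p ^ n0 * (1 - p) ^ k else 0

/-- The negative binomial series: `∑ C(n0+k-1, n0-1) s^k = (1-s)^{-n0}`. -/
theorem hasSum_negBinomial {n0 : ℕ} (hn0 : 1 ≤ n0) {s : ℝ} (hs0 : 0 ≤ s) (hs1 : s < 1) :
    HasSum (fun k : ℕ => ((n0 + k - 1).choose (n0 - 1) : ℝ) * s ^ k) (1 / (1 - s) ^ n0) := by
  obtain ⟨m, rfl⟩ : ∃ m, n0 = m + 1 := ⟨n0 - 1, by omega⟩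
  have hidx : ∀ k, m + 1 + k - 1 = k + m := fun k => by omega
  simp only [hidx, Nat.add_sub_cancel]
  exact hasSum_choose_mul_geometric_of_norm_lt_one m (by rwa [Real.norm_of_nonneg hs0])

/-- Chernoff bound for the upper tail, with tilted failure probability `s ≥ 1 - p`. -/
theorem nbProb_ge_le {n0 : ℕ} (hn0 : 1 ≤ n0) {p s : ℝ} (hp : 0 < p) (hp1 : p < 1)
    (hs : 1 - p ≤ s) (hs1 : s < 1) (x : ℝ) :
    nbProb n0 p (fun m => (m : ℝ) ≥ x) ≤
      p ^ n0 * ((1 - p) / s) ^ (x - (n0 : ℝ)) * (1 / (1 - s) ^ n0) := by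
  have hq : 0 < 1 - p := sub_pos.2 hp1
  have hs0 : 0 < s := hq.trans_le hs
  have hr : 0 < (1 - p) / s := div_pos hq hs0
  have hsum := (hasSum_negBinomial hn0 hs0.le hs1).mul_left
    (p ^ n0 * ((1 - p) / s) ^ (x - (n0 : ℝ)))
  have hle : ∀ k : ℕ,
      (if ((n0 + k : ℕ) : ℝ) ≥ x then
        ((n0 + k - 1).choose (n0 - 1) : ℝ) * p ^ n0 * (1 - p) ^ k else 0) ≤
      p ^ n0 * ((1 - p) / s) ^ (x - (n0 : ℝ)) *
        (((n0 + k - 1).choose (n0 - 1) : ℝ) * s ^ k) := by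
    intro k
    split_ifs with hk
    · have hpow : ((1 - p) / s) ^ k ≤ ((1 - p) / s) ^ (x - (n0 : ℝ)) := by
        rw [← Real.rpow_natCast]
        refine Real.rpow_le_rpow_of_exponent_ge hr ((div_le_one hs0).2 hs) ?_
        push_cast at hk
        linarith
      calc ((n0 + k - 1).choose (n0 - 1) : ℝ) * p ^ n0 * (1 - p) ^ k
          = p ^ n0 * ((1 - p) / s) ^ k * (((n0 + k - 1).choose (n0 - 1) : ℝ) * s ^ k) := by
            rw [div_pow]
            field_simp
        _ ≤ _ := by gcongr
    · positivity
  unfold nbProb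
  rw [← hsum.tsum_eq]
  refine Summable.tsum_le_tsum (fun k => ?_) (.of_nonneg_of_le (fun k => ?_) (fun k => ?_)
    hsum.summable) hsum.summable
  · convert hle k
  · split_ifs <;> positivity
  · convert hle k

/-- for every real `x > n0/p`, the upper-tail Chernoff bound
`P(N ≥ x) ≤ (1−p)^{x−n0} x^x p^{n0} / ((x−n0)^{x−n0} n0^{n0})` holds, where powers with
real exponents are real (`rpow`) powers of positive bases. -/
theorem stmt15 (n0 : ℕ) (hn0 : 1 ≤ n0) (p : ℝ) (hp : 0 < p) (hp1 : p < 1)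
    (x : ℝ) (hx : x > (n0 : ℝ) / p) :
    nbProb n0 p (fun m => (m : ℝ) ≥ x) ≤
      (1 - p) ^ (x - (n0 : ℝ)) * x ^ x * p ^ n0 /
        ((x - (n0 : ℝ)) ^ (x - (n0 : ℝ)) * (n0 : ℝ) ^ n0) := by
  have hn : (0 : ℝ) < n0 := by exact_mod_cast hn0
  have hx0 : 0 < x := (div_pos hn hp).trans hx
  have hxp : (n0 : ℝ) < x * p := (div_lt_iff₀ hp).1 hx
  have hxn : 0 < x - n0 := by nlinarith
  have hs : 1 - p ≤ (x - n0) / x := by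
    rw [le_div_iff₀ hx0]
    linarith
  have hs1 : (x - n0) / x < 1 := by
    rw [div_lt_one hx0]
    linarith
  refine (nbProb_ge_le hn0 hp hp1 hs hs1 x).trans_eq ?_
  have hcompl : 1 - (x - n0) / x = n0 / x := by
    field_simp
    ring
  have hxx : x ^ x = x ^ (x - (n0 : ℝ)) * x ^ n0 := by
    rw [← Real.rpow_natCast x n0, ← Real.rpow_add hx0, sub_add_cancel]
  rw [hcompl, hxx, div_div_eq_mul_div, Real.div_rpow (mul_nonneg (sub_pos.2 hp1).le hx0.le) hxn.le,
    Real.mul_rpow (sub_pos.2 hp1).le hx0.le, div_pow]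
  field_simp
end
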